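/- arXiv:1303.5188 — 2 statements merged into one kernel-verified Lean document; each statement's English description precedes it below -/
import Mathlib

section
/- P = (r/p)^i · (−1/p)^i · c_p^{δ_i} · p^{i/2} · P₁, where P = Σ_{c∈ℤ/p^iℤ} Σ_{d∈(ℤ/p^iℤ)^×} λ(p^j βd + d⁻¹(p^k b − c²)) and P₁ = Σ_{d∈(ℤ/p^iℤ)^×} (d/p)^i · λ(p^j βd + p^k b d⁻¹). (§4: reduction of the double sum P to the single sum P₁ via the quadratic Gauss sum.) -/
noncomputable section
open Matrix Complex

/-- The additive character `x ↦ ζ_N^{r·x} = exp(2πi·r·x/N)` of `ZMod N`. -/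
def aChar (N : ℕ) (r : ℤ) (x : ZMod N) : ℂ :=
  Complex.exp (2 * Real.pi * Complex.I * (r : ℂ) * (x.val : ℂ) / (N : ℂ))

/-- The Legendre symbol `(x/p)` of an element `x : ZMod N` (via its residue mod `p`). -/
def legC (p : ℕ) [Fact p.Prime] {N : ℕ} (x : ZMod N) : ℂ :=
  (legendreSym p (x.val : ℤ) : ℂ)

/-- `c_p = (−1/p)^{1/2}`: `1` if `p ≡ 1 (mod 4)` and `√−1` if `p ≡ 3 (mod 4)`. -/
def cP (p : ℕ) : ℂ := if p % 4 = 1 then 1 else Complex.I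

open Polynomial in
/-- Applying the Euler operator `X * d/dX` to `(X - 1) ^ N` exactly `n` times leaves a factor
`(X - 1) ^ (N - n)`, whose cofactor takes the value `N (N - 1) ⋯ (N - n + 1)` at `1`. -/
theorem exists_euler_operator_iterate_eq {R : Type*} [CommRing R] (n M : ℕ) :
    ∃ Q : R[X], (fun f : R[X] => X * derivative f)^[n] ((X - 1) ^ (M + n)) = (X - 1) ^ M * Q ∧
      Q.eval 1 = ((M + n).descFactorial n : R) := by
  induction n generalizing M with
  | zero => exact ⟨1, by simp, by simp⟩
  | succ n ih =>
    obtain ⟨Q, hQ, hQ1⟩ := ih (M + 1)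
    refine ⟨X * (C ((M : R) + 1) * Q + (X - 1) * derivative Q), ?_, ?_⟩
    · rw [Function.iterate_succ_apply', show M + (n + 1) = M + 1 + n by ring, hQ]
      simp only [derivative_mul, derivative_pow, derivative_sub, derivative_X, derivative_one]
      simp only [add_tsub_cancel_right, C_add, C_1, map_natCast]
      push_cast
      ring
    · simp only [eval_mul, eval_add, eval_X, eval_C, eval_sub, eval_one, hQ1]
      rw [show M + (n + 1) = M + 1 + n by ring, Nat.descFactorial_succ,
        show M + 1 + n - n = M + 1 by omega]
      push_cast
      ring

open Polynomial in
theorem euler_operator_iterate_sum {R : Type*} [CommRing R] (n N : ℕ) (a : ℕ → R) :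
    (fun f : R[X] => X * derivative f)^[n] (∑ j ∈ Finset.range N, C (a j) * X ^ j) =
      ∑ j ∈ Finset.range N, C (a j * (j : R) ^ n) * X ^ j := by
  induction n with
  | zero => simp
  | succ n ih =>
    rw [Function.iterate_succ_apply', ih]
    simp only [derivative_sum, Finset.mul_sum]
    refine Finset.sum_congr rfl fun j _ => ?_
    rcases j with _ | j
    · rw [pow_zero, mul_one, mul_one, derivative_C, Nat.cast_zero, zero_pow n.succ_ne_zero]
      simp
    · rw [derivative_C_mul, derivative_X_pow, pow_succ (((j + 1 : ℕ) : R)), C_mul, C_mul, C_mul,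
        add_tsub_cancel_right]
      ring

open Polynomial in
/-- `X ^ k - 1 = (X - 1) * (1 + X + ⋯ + X ^ (k - 1))` multiplied over `k = 1, …, m`. -/
theorem exists_prod_X_pow_sub_one_eq {R : Type*} [CommRing R] (m : ℕ) (e : ℕ → ℕ) :
    ∃ Q : R[X], ∏ k ∈ Finset.range m, (X ^ e k * (X ^ (k + 1) - 1)) = (X - 1) ^ m * Q ∧
      Q.eval 1 = (m.factorial : R) := by
  refine ⟨∏ k ∈ Finset.range m, (X ^ e k * ∑ j ∈ Finset.range (k + 1), X ^ j), ?_, ?_⟩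
  · rw [← Finset.card_range m, ← Finset.prod_const, Finset.card_range, ← Finset.prod_mul_distrib]
    refine Finset.prod_congr rfl fun k _ => ?_
    rw [← mul_geom_sum]
    ring
  · rw [eval_prod, ← Finset.prod_range_add_one_eq_factorial]
    push_cast
    refine Finset.prod_congr rfl fun k _ => ?_
    simp [eval_finsetSum]

theorem zmod_descFactorial_two_mul {p m : ℕ} (hpm : p = 2 * m + 1) (n : ℕ) (hn : n ≤ m) :
    ((2 * m).descFactorial n : ZMod p) = (-1) ^ n * n.factorial := by
  induction n with
  | zero => simp
  | succ n ih =>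
    have h : ((2 * m + 1 : ℕ) : ZMod p) = 0 := by rw [← hpm]; simp
    rw [Nat.descFactorial_succ, Nat.factorial_succ, Nat.cast_mul, ih (by omega),
      Nat.cast_sub (by omega)]
    push_cast at h ⊢
    linear_combination (-1) ^ n * (n.factorial : ZMod p) * h

open Polynomial in
/-- Comparison of the quadratic Gauss sum with the product `∏ (ζ ^ k - 1)` modulo a power
of `1 - ζ`. -/
theorem quadratic_gauss_sum_prod_coeff {p m : ℕ} [Fact p.Prime] (hpm : p = 2 * m + 1) {ζ : ℂ}
    (hζ : IsPrimitiveRoot ζ p) (e : ℕ → ℕ) (ε : ℤ)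
    (h : ∑ j ∈ Finset.range p, (legendreSym p j : ℂ) * ζ ^ j =
      ε * ∏ k ∈ Finset.range m, (ζ ^ e k * (ζ ^ (k + 1) - 1))) :
    (ε : ZMod p) = (-1) ^ m := by
  have hp : p.Prime := Fact.out
  have hm : 0 < m := by have := hp.two_le; omega
  let F : ℤ[X] := ∑ j ∈ Finset.range p, C (legendreSym p j) * X ^ j -
    C ε * ∏ k ∈ Finset.range m, (X ^ e k * (X ^ (k + 1) - 1))
  have hF : aeval ζ F = 0 := by
    simp only [F, map_sub, map_sum, map_mul, map_prod, map_pow, aeval_X, map_one, aeval_C]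
    simp [h]
  have hdvd : cyclotomic p ℤ ∣ F := by
    rw [cyclotomic_eq_minpoly hζ hp.pos]
    exact minpoly.isIntegrallyClosed_dvd (hζ.isIntegral hp.pos) hF
  have hcyc : cyclotomic p (ZMod p) = (X - 1) ^ (2 * m) := by
    have h1 := cyclotomic_prime_mul_X_sub_one (ZMod p) p
    have h2 : (X ^ p - 1 : (ZMod p)[X]) = (X - 1) ^ p := by
      rw [sub_pow_char, one_pow]
    rw [h2] at h1
    have h3 : (X - 1 : (ZMod p)[X]) ≠ 0 := X_sub_C_ne_zero 1
    apply mul_right_cancel₀ h3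
    rw [h1, ← pow_succ, ← hpm]
  have hdvd' : (X - 1 : (ZMod p)[X]) ^ (2 * m) ∣ F.map (Int.castRingHom (ZMod p)) := by
    rw [← hcyc, ← map_cyclotomic p (Int.castRingHom (ZMod p))]
    exact map_dvd (mapRingHom (Int.castRingHom (ZMod p))) hdvd
  obtain ⟨Q, hQ, hQ1⟩ := exists_euler_operator_iterate_eq (R := ZMod p) m m
  obtain ⟨T, hT, hT1⟩ := exists_prod_X_pow_sub_one_eq (R := ZMod p) m e
  have hsum : ∑ j ∈ Finset.range p, C ((legendreSym p j : ℤ) : ZMod p) * X ^ j =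
      (X - 1) ^ m * Q := by
    rw [← hQ, ← two_mul, ← hcyc, cyclotomic_prime]
    have := euler_operator_iterate_sum m p (fun _ => (1 : ZMod p))
    simp only [map_one, one_mul] at this
    rw [this]
    refine Finset.sum_congr rfl fun j _ => ?_
    rw [legendreSym.eq_pow, show p / 2 = m by omega]
    simp
  have hFm : F.map (Int.castRingHom (ZMod p)) = (X - 1) ^ m * (Q - C (ε : ZMod p) * T) := by
    simp only [F, Polynomial.map_sub, Polynomial.map_sum, Polynomial.map_mul, Polynomial.map_prod,
      Polynomial.map_pow, map_X, Polynomial.map_one, map_C, Int.coe_castRingHom]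
    rw [hsum, hT]
    ring
  rw [hFm, two_mul, pow_add] at hdvd'
  have hne : (X - 1 : (ZMod p)[X]) ^ m ≠ 0 := pow_ne_zero _ (X_sub_C_ne_zero 1)
  have h4 : (X - C 1 : (ZMod p)[X]) ∣ Q - C (ε : ZMod p) * T :=
    (dvd_pow_self _ hm.ne').trans ((mul_dvd_mul_iff_left hne).1 hdvd')
  rw [dvd_iff_isRoot, IsRoot, eval_sub, eval_mul, eval_C, hQ1, hT1, ← two_mul,
    zmod_descFactorial_two_mul hpm m le_rfl, ← sub_mul] at h4
  have hfac : (m.factorial : ZMod p) ≠ 0 := by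
    rw [Ne, ZMod.natCast_eq_zero_iff, hp.dvd_factorial]
    omega
  exact (sub_eq_zero.1 ((mul_eq_zero.1 h4).resolve_right hfac)).symm

open Real in
theorem prod_two_sin_sq {m : ℕ} :
    (∏ k ∈ Finset.range m, (2 * Real.sin (π * (k + 1) / (2 * m + 1)))) ^ 2 = 2 * m + 1 := by
  have hζ := Complex.isPrimitiveRoot_exp (2 * m + 1) (by omega)
  have h := congrArg norm hζ.prod_one_sub_pow_eq_order
  have hn : ∀ k ∈ Finset.range (2 * m), ‖1 - Complex.exp (2 * π * I / (2 * m + 1 : ℕ)) ^ (k + 1)‖ =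
      2 * Real.sin (π * (k + 1) / (2 * m + 1)) := by
    intro k hk
    have hk' : (k : ℝ) + 1 ≤ 2 * m := by exact_mod_cast Finset.mem_range.1 hk
    rw [← Complex.exp_nat_mul, norm_sub_rev,
      show ((k + 1 : ℕ) : ℂ) * (2 * π * I / (2 * m + 1 : ℕ)) =
        I * ((2 * (π * (k + 1) / (2 * m + 1)) : ℝ) : ℂ) by push_cast; ring,
      Complex.norm_exp_I_mul_ofReal_sub_one, mul_div_cancel_left₀ _ two_ne_zero, Real.norm_eq_abs,
      abs_of_nonneg]
    refine mul_nonneg zero_le_two (Real.sin_nonneg_of_nonneg_of_le_pi (by positivity) ?_)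
    rw [div_le_iff₀ (by positivity)]
    nlinarith [Real.pi_pos]
  rw [norm_prod, Finset.prod_congr rfl hn, two_mul, Finset.prod_range_add,
    ← Finset.prod_range_reflect (fun x => 2 * Real.sin (π * ((m + x : ℕ) + 1) / (2 * m + 1)))] at h
  rw [sq]
  convert h using 1
  · congr 1
    refine Finset.prod_congr rfl fun k hk => ?_
    have hk := Finset.mem_range.1 hk
    rw [← Real.sin_pi_sub]
    congr 2
    rw [show m + (m - 1 - k) = 2 * m - (k + 1) by omega, Nat.cast_sub (by omega)]
    field_simp
    push_cast
    ring
  · rw [show ((m + m : ℕ) : ℂ) + 1 = ((2 * m + 1 : ℝ) : ℂ) by push_cast; ring, Complex.norm_real,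
      Real.norm_of_nonneg (by positivity)]

open Real in
theorem prod_exp_sub_one_eq (m : ℕ) :
    ∏ k ∈ Finset.range m, (Complex.exp (2 * π * I / (2 * m + 1 : ℕ)) ^ (m * (k + 1)) *
      (Complex.exp (2 * π * I / (2 * m + 1 : ℕ)) ^ (k + 1) - 1)) =
      (∏ k ∈ Finset.range m, (-1) ^ (k + 1)) * I ^ m * (√(2 * m + 1 : ℝ) : ℂ) := by
  have hs : √(2 * m + 1 : ℝ) = ∏ k ∈ Finset.range m, (2 * Real.sin (π * (k + 1) / (2 * m + 1))) := by
    refine (congrArg Real.sqrt prod_two_sin_sq).symm.trans (Real.sqrt_sq ?_)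
    refine Finset.prod_nonneg fun k hk => ?_
    have hk' : (k : ℝ) + 1 ≤ m := by exact_mod_cast Finset.mem_range.1 hk
    refine mul_nonneg zero_le_two (Real.sin_nonneg_of_nonneg_of_le_pi (by positivity) ?_)
    rw [div_le_iff₀ (by positivity)]
    nlinarith [Real.pi_pos]
  have hI : I ^ m = ∏ k ∈ Finset.range m, I := by simp
  rw [hs, hI]
  push_cast
  rw [← Finset.prod_mul_distrib, ← Finset.prod_mul_distrib]
  refine Finset.prod_congr rfl fun k _ => ?_
  have hm : (2 * m + 1 : ℂ) ≠ 0 := by exact_mod_cast (by omega : 2 * m + 1 ≠ 0)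
  have h1 : Complex.exp (2 * π * I / (2 * m + 1)) ^ (m * (k + 1)) =
      (-1) ^ (k + 1) * Complex.exp (-(π * (k + 1) / (2 * m + 1)) * I) := by
    rw [← Complex.exp_pi_mul_I, ← Complex.exp_nat_mul, ← Complex.exp_nat_mul, ← Complex.exp_add]
    have h : (m : ℂ) * 2 / (2 * m + 1) = 1 - 1 / (2 * m + 1) := by
      rw [eq_sub_iff_add_eq, ← add_div, div_eq_one_iff_eq hm, mul_comm]
    congr 1
    push_cast
    linear_combination (k + 1) * π * I * h
  have h2 : Complex.exp (2 * π * I / (2 * m + 1)) ^ (k + 1) =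
      Complex.exp ((π * (k + 1) / (2 * m + 1)) * I) *
        Complex.exp ((π * (k + 1) / (2 * m + 1)) * I) := by
    rw [← Complex.exp_nat_mul, ← Complex.exp_add]
    congr 1
    push_cast
    ring
  have h3 : Complex.exp (-(π * (k + 1) / (2 * m + 1)) * I) *
      Complex.exp ((π * (k + 1) / (2 * m + 1)) * I) = 1 := by
    rw [← Complex.exp_add]
    simp
  have h4 := Complex.two_sin (π * (k + 1) / (2 * m + 1) : ℂ)
  rw [h1, h2, h4]
  linear_combination (-1) ^ (k + 1) * Complex.exp ((π * (k + 1) / (2 * m + 1)) * I) * h3 +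
    (-1) ^ (k + 1) * (Complex.exp ((π * (k + 1) / (2 * m + 1)) * I) -
      Complex.exp (-(π * (k + 1) / (2 * m + 1)) * I)) * I_sq

theorem sum_zmod_eq_sum_range {A : Type*} [AddCommMonoid A] {N : ℕ} [NeZero N] (f : ZMod N → A) :
    ∑ c, f c = ∑ j ∈ Finset.range N, f j :=
  Finset.sum_nbij' ZMod.val (fun j => (j : ZMod N)) (fun c _ => Finset.mem_range.2 c.val_lt)
    (fun _ _ => Finset.mem_univ _) (fun c _ => ZMod.natCast_zmod_val c)
    (fun _ hj => ZMod.val_cast_of_lt (Finset.mem_range.1 hj))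
    (fun c _ => by rw [ZMod.natCast_zmod_val])

/-- The quadratic character modulo `p` with values in `ℂ`. -/
def complexQuadraticChar (p : ℕ) [Fact p.Prime] : MulChar (ZMod p) ℂ :=
  (quadraticChar (ZMod p)).ringHomComp (Int.castRingHom ℂ)

theorem complexQuadraticChar_intCast (p : ℕ) [Fact p.Prime] (a : ℤ) :
    complexQuadraticChar p (a : ZMod p) = legendreSym p a := rfl

theorem cP_two_mul_add_one (m : ℕ) :
    cP (2 * m + 1) = (-1) ^ m * ((∏ k ∈ Finset.range m, (-1) ^ (k + 1)) * I ^ m) := by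
  have h : ∀ l : ℕ, (∏ k ∈ Finset.range (2 * l), (-1 : ℂ) ^ (k + 1)) = (-1) ^ l := by
    intro l
    induction l with
    | zero => simp
    | succ l ih =>
      rw [show 2 * (l + 1) = 2 * l + 1 + 1 by ring, Finset.prod_range_succ, Finset.prod_range_succ,
        ih]
      have : ((-1 : ℂ) ^ l) ^ 2 = 1 := by rw [← pow_mul, pow_mul', neg_one_sq, one_pow]
      simp only [pow_succ, pow_mul', pow_zero]
      linear_combination (-(-1 : ℂ) ^ l) * (((-1 : ℂ) ^ l) ^ 2 + 1) * this
  have h1 : ∀ l : ℕ, (-1 : ℂ) ^ l * (-1) ^ l = 1 := fun l => by rw [← mul_pow]; simp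
  unfold cP
  rcases Nat.even_or_odd' m with ⟨l, rfl | rfl⟩
  · rw [if_pos (by omega), h, pow_mul, pow_mul, I_sq, neg_one_sq, one_pow, one_mul, h1]
  · rw [if_neg (by omega), Finset.prod_range_succ, h, pow_succ I, pow_mul I, I_sq, pow_succ,
      pow_mul, neg_one_sq, one_pow]
    linear_combination (-I) * h1 l

theorem gaussSum_complexQuadraticChar {p : ℕ} [Fact p.Prime] (hp : p ≠ 2) :
    gaussSum (complexQuadraticChar p) ZMod.stdAddChar = cP p * (√(p : ℝ) : ℂ) := by
  have hpp : p.Prime := Fact.out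
  obtain ⟨m, hpm⟩ := hpp.odd_of_ne_two hp
  have hchar : ringChar (ZMod p) ≠ 2 := by rwa [ZMod.ringChar_zmod_n]
  have hζ := Complex.isPrimitiveRoot_exp p hpp.ne_zero
  have hsum : gaussSum (complexQuadraticChar p) ZMod.stdAddChar = ∑ j ∈ Finset.range p,
      (legendreSym p j : ℂ) * Complex.exp (2 * Real.pi * I / p) ^ j := by
    rw [gaussSum, sum_zmod_eq_sum_range]
    refine Finset.sum_congr rfl fun j _ => ?_
    have := ZMod.stdAddChar_coe (N := p) (j : ℤ)
    have h := complexQuadraticChar_intCast p (j : ℤ)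
    rw [Int.cast_natCast] at this h
    rw [this, h, ← Complex.exp_nat_mul]
    congr 2
    push_cast
    ring
  have hsq : gaussSum (complexQuadraticChar p) ZMod.stdAddChar ^ 2 = (-1) ^ m * p := by
    rw [gaussSum_sq, ZMod.card]
    · have h := complexQuadraticChar_intCast p (-1)
      rw [legendreSym.at_neg_one hp, ZMod.χ₄_eq_neg_one_pow (by omega),
        show p / 2 = m by omega] at h
      push_cast at h
      rw [h]
    · exact (MulChar.ringHomComp_ne_one_iff (RingHom.injective_int _)).2 (quadraticChar_ne_one hchar)
    · exact (quadraticChar_isQuadratic (ZMod p)).comp _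
    · exact ZMod.isPrimitive_stdAddChar p
  have hprod := prod_exp_sub_one_eq m
  have hcP := cP_two_mul_add_one m
  rw [← hpm] at hprod hcP
  have hpR : (2 * m + 1 : ℝ) = p := by rw [hpm]; push_cast; ring
  rw [hpR] at hprod
  have hsqrt : (√(p : ℝ) : ℂ) ^ 2 = p := by
    rw [← Complex.ofReal_pow, Real.sq_sqrt (Nat.cast_nonneg p), Complex.ofReal_natCast]
  set s : ℂ := ∏ k ∈ Finset.range m, (-1) ^ (k + 1) with hs
  have hs2 : s ^ 2 = 1 := by
    rw [hs, ← Finset.prod_pow]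
    exact Finset.prod_eq_one fun k _ => by rw [← pow_mul, pow_mul', neg_one_sq, one_pow]
  have hI : (I ^ m) ^ 2 = (-1) ^ m := by rw [← pow_mul, pow_mul', I_sq]
  have hne : (-1 : ZMod p) ^ m ≠ -(-1) ^ m := by
    have := Ring.neg_one_ne_one_of_char_ne_two hchar
    rcases neg_one_pow_eq_or (ZMod p) m with h | h <;> rw [h]
    · exact this.symm
    · rwa [neg_neg]
  rw [hsum] at hsq ⊢
  set g := ∑ j ∈ Finset.range p, (legendreSym p j : ℂ) * Complex.exp (2 * Real.pi * I / p) ^ j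
    with hg
  have key : g ^ 2 = (s * I ^ m * (√(p : ℝ) : ℂ)) ^ 2 := by
    rw [hsq, mul_pow, mul_pow, hs2, hI, hsqrt, one_mul]
  have hε : ∃ ε : ℤ, (ε = (-1) ^ m ∨ ε = -(-1) ^ m) ∧ g = ε * (s * I ^ m * (√(p : ℝ) : ℂ)) := by
    rcases neg_one_pow_eq_or ℤ m with h | h <;> rcases sq_eq_sq_iff_eq_or_eq_neg.1 key with h' | h'
    · exact ⟨1, by simp [h], by simp [h']⟩
    · exact ⟨-1, by simp [h], by simp [h']⟩
    · exact ⟨1, by simp [h], by simp [h']⟩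
    · exact ⟨-1, by simp [h], by simp [h']⟩
  obtain ⟨ε, hε, hgε⟩ := hε
  have hmod := quadratic_gauss_sum_prod_coeff hpm hζ (fun k => m * (k + 1)) ε
    (by rw [hprod]; exact hgε)
  rcases hε with rfl | rfl
  · rw [hgε, hcP]
    push_cast
    ring
  · push_cast at hmod
    exact absurd hmod.symm hne

theorem sum_stdAddChar_mul_sq_prime {p : ℕ} [Fact p.Prime] (hp : p ≠ 2) (a : ℤ)
    (ha : ¬ (p : ℤ) ∣ a) :
    ∑ c : ZMod p, ZMod.stdAddChar ((a : ZMod p) * c ^ 2) =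
      legendreSym p a * (cP p * (√(p : ℝ) : ℂ)) := by
  have hchar : ringChar (ZMod p) ≠ 2 := by rwa [ZMod.ringChar_zmod_n]
  have ha0 : (a : ZMod p) ≠ 0 := by rwa [Ne, ZMod.intCast_zmod_eq_zero_iff_dvd]
  have hcard : ∀ t : ZMod p, ((Finset.univ.filter fun c : ZMod p => c ^ 2 = t).card : ℂ) =
      complexQuadraticChar p t + 1 := by
    intro t
    have h := quadraticChar_card_sqrts hchar t
    simp only [Set.toFinset_ofPred] at h
    have h' := congrArg (Int.cast : ℤ → ℂ) h
    push_cast at h'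
    exact h'
  have hfib : ∑ c : ZMod p, ZMod.stdAddChar ((a : ZMod p) * c ^ 2) =
      ∑ t : ZMod p, (complexQuadraticChar p t + 1) * ZMod.stdAddChar ((a : ZMod p) * t) := by
    rw [← Finset.sum_fiberwise Finset.univ (fun c : ZMod p => c ^ 2)]
    refine Finset.sum_congr rfl fun t _ => ?_
    rw [← hcard, ← nsmul_eq_mul, ← Finset.sum_const]
    refine Finset.sum_congr rfl fun c hc => ?_
    rw [(Finset.mem_filter.1 hc).2]
  have hzero : ∑ t : ZMod p, ZMod.stdAddChar ((a : ZMod p) * t) = (0 : ℂ) := by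
    have h := AddChar.sum_mulShift (a : ZMod p) (ZMod.isPrimitive_stdAddChar p)
    rw [if_neg ha0] at h
    simpa [mul_comm] using h
  have hshift := gaussSum_mulShift (complexQuadraticChar p) ZMod.stdAddChar (Units.mk0 _ ha0)
  rw [Units.val_mk0, complexQuadraticChar_intCast, gaussSum_complexQuadraticChar hp] at hshift
  have hsq : (legendreSym p a : ℂ) ^ 2 = 1 := by exact_mod_cast legendreSym.sq_one p ha0
  rw [hfib]
  simp only [add_mul, one_mul, Finset.sum_add_distrib, hzero, add_zero]
  change gaussSum (complexQuadraticChar p) (ZMod.stdAddChar.mulShift (a : ZMod p)) = _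
  linear_combination (-gaussSum (complexQuadraticChar p) (ZMod.stdAddChar.mulShift (a : ZMod p))) *
    hsq + (legendreSym p a : ℂ) * hshift

theorem stdAddChar_mul_intCast {K N L : ℕ} [NeZero N] [NeZero L] (h : L = K * N) (z : ℤ) :
    ZMod.stdAddChar (((K * z : ℤ)) : ZMod L) = ZMod.stdAddChar (z : ZMod N) := by
  have hL : (L : ℂ) ≠ 0 := Nat.cast_ne_zero.2 (NeZero.ne L)
  subst h
  rw [Nat.cast_mul] at hL
  have hK := left_ne_zero_of_mul hL
  have hN := right_ne_zero_of_mul hL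
  rw [ZMod.stdAddChar_coe, ZMod.stdAddChar_coe]
  congr 1
  push_cast
  field_simp

theorem sum_range_mul_eq {A : Type*} [AddCommMonoid A] (M q : ℕ) (f : ℕ → A) :
    ∑ c ∈ Finset.range (M * q), f c =
      ∑ y ∈ Finset.range q, ∑ x ∈ Finset.range M, f (M * y + x) := by
  induction q with
  | zero => simp
  | succ q ih => rw [Nat.mul_succ, Finset.sum_range_add, ih, Finset.sum_range_succ]

theorem sum_stdAddChar_mul_sq_pow_add_two {p : ℕ} [Fact p.Prime] (hp : p ≠ 2) (a : ℤ)
    (ha : ¬ (p : ℤ) ∣ a) (n : ℕ) :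
    ∑ c : ZMod (p ^ (n + 2)), ZMod.stdAddChar ((a : ZMod (p ^ (n + 2))) * c ^ 2) =
      p * ∑ c : ZMod (p ^ n), ZMod.stdAddChar ((a : ZMod (p ^ n)) * c ^ 2) := by
  have hpp : p.Prime := Fact.out
  have h2a : ∀ x : ℕ, ((2 * a * x : ℤ) : ZMod p) = 0 ↔ (x : ZMod p) = 0 := by
    intro x
    have ha0 : (a : ZMod p) ≠ 0 := by rwa [Ne, ZMod.intCast_zmod_eq_zero_iff_dvd]
    have h20 : (2 : ZMod p) ≠ 0 := by
      apply Ring.two_ne_zero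
      rwa [ZMod.ringChar_zmod_n]
    push_cast
    simp [ha0, h20]
  have hexp : ∀ x y : ℕ, ZMod.stdAddChar ((a : ZMod (p ^ (n + 2))) *
      ((p ^ (n + 1) * y + x : ℕ) : ZMod (p ^ (n + 2))) ^ 2) =
      ZMod.stdAddChar ((a : ZMod (p ^ (n + 2))) * (x : ZMod (p ^ (n + 2))) ^ 2) *
        ZMod.stdAddChar ((y : ZMod p) * ((2 * a * x : ℤ) : ZMod p)) := by
    intro x y
    have h1 : (y : ZMod p) * ((2 * a * x : ℤ) : ZMod p) = ((y * (2 * a * x) : ℤ) : ZMod p) := by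
      push_cast
      ring
    have h0 : ((p : ZMod (p ^ (n + 2))) ^ (n + 2)) = 0 := by
      exact_mod_cast ZMod.natCast_self (p ^ (n + 2))
    rw [h1, ← stdAddChar_mul_intCast (K := p ^ (n + 1)) (L := p ^ (n + 2)) (by ring),
      ← AddChar.map_add_eq_mul]
    congr 1
    push_cast
    linear_combination (a : ZMod (p ^ (n + 2))) * p ^ n * y ^ 2 * h0
  have hinner : ∀ x : ℕ, ∑ y ∈ Finset.range p,
      ZMod.stdAddChar ((y : ZMod p) * ((2 * a * x : ℤ) : ZMod p)) =
        if (x : ZMod p) = 0 then (p : ℂ) else 0 := by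
    intro x
    rw [← sum_zmod_eq_sum_range (fun y : ZMod p => ZMod.stdAddChar (y * ((2 * a * x : ℤ) : ZMod p))),
      AddChar.sum_mulShift _ (ZMod.isPrimitive_stdAddChar p), ZMod.card]
    simp only [h2a]
    split_ifs <;> simp
  have hblock : ∀ z : ℕ, ∑ w ∈ Finset.range p,
      ZMod.stdAddChar ((a : ZMod (p ^ (n + 2))) * ((p * z + w : ℕ) : ZMod (p ^ (n + 2))) ^ 2) *
        (if ((p * z + w : ℕ) : ZMod p) = 0 then (p : ℂ) else 0) =
      p * ZMod.stdAddChar ((a : ZMod (p ^ n)) * (z : ZMod (p ^ n)) ^ 2) := by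
    intro z
    have hcast : (((a * z ^ 2 : ℤ)) : ZMod (p ^ n)) = (a : ZMod (p ^ n)) * (z : ZMod (p ^ n)) ^ 2 := by
      push_cast
      ring
    rw [Finset.sum_eq_single 0, if_pos (by simp), mul_comm, ← hcast,
      ← stdAddChar_mul_intCast (K := p ^ 2) (L := p ^ (n + 2)) (by ring)]
    · congr 2
      push_cast
      ring
    · intro w hw hw0
      rw [if_neg, mul_zero]
      rw [ZMod.natCast_eq_zero_iff, Nat.dvd_add_right (dvd_mul_right p z)]
      exact Nat.not_dvd_of_pos_of_lt (Nat.pos_of_ne_zero hw0) (Finset.mem_range.1 hw)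
    · exact fun h => absurd (Finset.mem_range.2 hpp.pos) h
  have hr1 : Finset.range (p ^ (n + 2)) = Finset.range (p ^ (n + 1) * p) := by rw [← pow_succ]
  have hr2 : Finset.range (p ^ (n + 1)) = Finset.range (p * p ^ n) := by rw [← pow_succ']
  rw [sum_zmod_eq_sum_range, sum_zmod_eq_sum_range, hr1, sum_range_mul_eq, Finset.sum_comm]
  simp_rw [hexp, ← Finset.mul_sum, hinner]
  rw [hr2, sum_range_mul_eq, Finset.sum_congr rfl fun z _ => hblock z, Finset.mul_sum]

/-- The quadratic Gauss sum modulo an odd prime power. -/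
theorem sum_stdAddChar_mul_sq_prime_pow {p : ℕ} [Fact p.Prime] (hp : p ≠ 2) (a : ℤ)
    (ha : ¬ (p : ℤ) ∣ a) (n : ℕ) :
    ∑ c : ZMod (p ^ n), ZMod.stdAddChar ((a : ZMod (p ^ n)) * c ^ 2) =
      (legendreSym p a : ℂ) ^ n * cP p ^ (if Odd n then 1 else 0) *
        (√((p : ℝ) ^ n) : ℂ) := by
  induction n using Nat.twoStepInduction with
  | zero =>
    have h : ∀ f : ZMod (p ^ 0) → ℂ, ∑ c, f c = f 0 := fun f =>
      (sum_zmod_eq_sum_range f).trans ((Finset.sum_range_one _).trans (by rw [Nat.cast_zero]))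
    rw [h, zero_pow two_ne_zero, mul_zero, AddChar.map_zero_eq_one]
    simp
  | one =>
    have h : ∀ q : ℕ, q = p → ∀ [NeZero q], ∑ c : ZMod q, ZMod.stdAddChar ((a : ZMod q) * c ^ 2) =
        legendreSym p a * (cP p * (√(p : ℝ) : ℂ)) := by
      rintro q rfl hq
      exact sum_stdAddChar_mul_sq_prime hp a ha
    rw [h _ (pow_one p)]
    simp [mul_assoc]
  | more n ih _ =>
    have ha0 : (a : ZMod p) ≠ 0 := by rwa [Ne, ZMod.intCast_zmod_eq_zero_iff_dvd]
    have hsq : (legendreSym p a : ℂ) ^ 2 = 1 := by exact_mod_cast legendreSym.sq_one p ha0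
    have hodd : Odd (n + 2) ↔ Odd n := by grind
    rw [sum_stdAddChar_mul_sq_pow_add_two hp a ha, ih, pow_add _ n 2, hsq, pow_add _ n 2,
      Real.sqrt_mul (by positivity), Real.sqrt_sq (Nat.cast_nonneg p)]
    simp only [hodd]
    push_cast
    ring

theorem aChar_eq_stdAddChar (N : ℕ) [NeZero N] (r : ℤ) (x : ZMod N) :
    aChar N r x = ZMod.stdAddChar ((r : ZMod N) * x) := by
  have h := ZMod.stdAddChar_coe (N := N) (r * x.val)
  push_cast [ZMod.natCast_zmod_val] at h
  rw [h, aChar]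
  congr 1
  ring

theorem legendreSym_val_inv {p n : ℕ} [Fact p.Prime] (hn : n ≠ 0) (d : (ZMod (p ^ n))ˣ) :
    legendreSym p ((d⁻¹ : (ZMod (p ^ n))ˣ) : ZMod (p ^ n)).val =
      legendreSym p (d : ZMod (p ^ n)).val := by
  have hdvd : p ∣ p ^ n := dvd_pow_self p hn
  have hval : ∀ x : ZMod (p ^ n), ((x.val : ℤ) : ZMod p) = ZMod.castHom hdvd (ZMod p) x := by
    intro x
    rw [ZMod.castHom_apply, Int.cast_natCast, ZMod.natCast_val]
  have hmul : ZMod.castHom hdvd (ZMod p) (d⁻¹ : (ZMod (p ^ n))ˣ) *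
      ZMod.castHom hdvd (ZMod p) (d : ZMod (p ^ n)) = 1 := by
    rw [← map_mul, Units.inv_mul, map_one]
  rw [← hval, ← hval] at hmul
  have h1 : legendreSym p ((d⁻¹ : (ZMod (p ^ n))ˣ) : ZMod (p ^ n)).val *
      legendreSym p (d : ZMod (p ^ n)).val = 1 := by
    rw [← legendreSym.mul, legendreSym, Int.cast_mul, hmul, map_one]
  rcases Int.mul_eq_one_iff_eq_one_or_neg_one.1 h1 with h | h <;> rw [h.1, h.2]

/-- §4: `P = (r/p)^i·(−1/p)^i·c_p^{δ_i}·p^{i/2}·P₁`, reducing the double sum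
`P = Σ_{c,d} λ(p^j βd + d⁻¹(p^k b − c²))` to the single sum
`P₁ = Σ_d (d/p)^i λ(p^j βd + p^k b d⁻¹)` via the quadratic Gauss sum. -/
theorem appendix_P_reduction (p i j k : ℕ) [Fact p.Prime] (hp : Odd p)
    (hi : 1 ≤ i) (hj1 : 1 ≤ j) (hji : j ≤ i) (hki : k ≤ i)
    (r : ℤ) (hpr : ¬ ((p : ℤ) ∣ r)) (β b : (ZMod (p ^ i))ˣ) :
    (∑ c : ZMod (p ^ i), ∑ d : (ZMod (p ^ i))ˣ,
        aChar (p ^ i) r ((p : ZMod (p ^ i)) ^ j * (β : ZMod (p ^ i)) * (d : ZMod (p ^ i)) +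
          ((d⁻¹ : (ZMod (p ^ i))ˣ) : ZMod (p ^ i)) *
            ((p : ZMod (p ^ i)) ^ k * (b : ZMod (p ^ i)) - c ^ 2)))
      = (legendreSym p r : ℂ) ^ i * (legendreSym p (-1) : ℂ) ^ i *
          cP p ^ (if Odd i then 1 else 0) * (Real.sqrt ((p : ℝ) ^ i) : ℂ) *
          ∑ d : (ZMod (p ^ i))ˣ,
            legC p (d : ZMod (p ^ i)) ^ i *
              aChar (p ^ i) r ((p : ZMod (p ^ i)) ^ j * (β : ZMod (p ^ i)) * (d : ZMod (p ^ i)) +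
                (p : ZMod (p ^ i)) ^ k * (b : ZMod (p ^ i)) *
                  ((d⁻¹ : (ZMod (p ^ i))ˣ) : ZMod (p ^ i))) := by
  have hp2 : p ≠ 2 := by
    rintro rfl
    exact absurd hp (by decide)
  have hpp : p.Prime := Fact.out
  rw [Finset.sum_comm, Finset.mul_sum]
  refine Finset.sum_congr rfl fun d _ => ?_
  set D : ZMod (p ^ i) := ((d⁻¹ : (ZMod (p ^ i))ˣ) : ZMod (p ^ i)) with hD
  have hleg : legendreSym p (D.val : ℤ) = legendreSym p ((d : ZMod (p ^ i)).val : ℤ) :=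
    legendreSym_val_inv (by omega) d
  have hDval : ¬ (p : ℤ) ∣ D.val := by
    rw [Int.natCast_dvd_natCast, ← hpp.coprime_iff_not_dvd]
    exact ((ZMod.val_coe_unit_coprime d⁻¹).coprime_dvd_right (dvd_pow_self p (by omega))).symm
  have ha : ¬ (p : ℤ) ∣ r * -1 * D.val := by
    intro h
    rcases (Nat.prime_iff_prime_int.1 hpp).dvd_or_dvd h with h | h
    · exact hpr (by simpa using h)
    · exact hDval h
  have hG := sum_stdAddChar_mul_sq_prime_pow hp2 (r * -1 * D.val) ha i
  rw [legendreSym.mul, legendreSym.mul, hleg] at hG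
  simp only [aChar_eq_stdAddChar, legC]
  have hterm : ∀ c : ZMod (p ^ i), ZMod.stdAddChar ((r : ZMod (p ^ i)) *
      ((p : ZMod (p ^ i)) ^ j * (β : ZMod (p ^ i)) * (d : ZMod (p ^ i)) +
        D * ((p : ZMod (p ^ i)) ^ k * (b : ZMod (p ^ i)) - c ^ 2))) =
      ZMod.stdAddChar ((r : ZMod (p ^ i)) *
        ((p : ZMod (p ^ i)) ^ j * (β : ZMod (p ^ i)) * (d : ZMod (p ^ i)) +
          (p : ZMod (p ^ i)) ^ k * (b : ZMod (p ^ i)) * D)) *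
        ZMod.stdAddChar (((r * -1 * D.val : ℤ) : ZMod (p ^ i)) * c ^ 2) := by
    intro c
    rw [← AddChar.map_add_eq_mul]
    congr 1
    push_cast [ZMod.natCast_zmod_val]
    ring
  rw [Finset.sum_congr rfl fun c _ => hterm c, ← Finset.mul_sum, hG]
  push_cast
  ring
end
end

section
/- Assume 0 ≤ k < j ≤ i. Then P₁ = Σ_{d∈(ℤ/p^iℤ)^×} (d/p)^i · λ(p^j βd + p^k b d⁻¹) equals: −p^{i−1} if k = i−1 and i is even; (br/p)·c_p·p^{i−1}·√p if k = i−1 and i is odd; and 0 if k < i−1. (§4, case (iii).) -/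
noncomputable section
open Matrix Complex

/-- `P₁ = Σ_{d ∈ (ℤ/p^i)^×} (d/p)^i · λ(p^j βd + p^k b d⁻¹)` with `λ = aChar (p^i) r`. -/
def P1 (p i : ℕ) [Fact p.Prime] (r : ℤ) (β b : (ZMod (p ^ i))ˣ) (j k : ℕ) : ℂ :=
  ∑ d : (ZMod (p ^ i))ˣ,
    legC p (d : ZMod (p ^ i)) ^ i *
      aChar (p ^ i) r ((p : ZMod (p ^ i)) ^ j * (β : ZMod (p ^ i)) * (d : ZMod (p ^ i)) +
        (p : ZMod (p ^ i)) ^ k * (b : ZMod (p ^ i)) * ((d⁻¹ : (ZMod (p ^ i))ˣ) : ZMod (p ^ i)))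

open Polynomial Finset in
theorem exists_sum_pow_mul_X_pow_eq (p : ℕ) [Fact p.Prime] (n : ℕ) (hn : n ≤ p - 1) :
    ∃ h : (ZMod p)[X], ∑ j ∈ range p, C ((j : ZMod p) ^ n) * X ^ j = (X - 1) ^ (p - 1 - n) * h ∧
      h.eval 1 = (-1) ^ n * (n.factorial : ZMod p) := by
  have hp : p.Prime := Fact.out
  induction n with
  | zero =>
    refine ⟨1, ?_, by simp⟩
    have h := (Commute.all (X : (ZMod p)[X]) 1).geom_sum₂_mul p
    have h0 : (X - 1 : (ZMod p)[X]) ≠ 0 := X_sub_C_ne_zero (1 : ZMod p)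
    apply mul_right_cancel₀ h0
    have h2 : (X - 1 : (ZMod p)[X]) ^ p = X ^ p - 1 := by
      rw [sub_pow_char]; simp
    rw [tsub_zero, mul_one, ← pow_succ, Nat.sub_add_cancel hp.one_le, h2]
    simpa using h
  | succ n ih =>
    obtain ⟨h, h1, h2⟩ := ih (by omega)
    obtain ⟨a, ha⟩ : ∃ a, p - 1 - n = a + 1 := ⟨p - 1 - n - 1, by omega⟩
    have ha' : p - 1 - (n + 1) = a := by omega
    rw [ha] at h1
    have hc : ((a : ZMod p) + 1) = -(n + 1) := by
      have : ((a + 1 + n + 1 : ℕ) : ZMod p) = 0 := by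
        rw [show a + 1 + n + 1 = p by omega]; simp
      push_cast at this
      linear_combination this
    refine ⟨C ((a : ZMod p) + 1) * X * h + (X - 1) * X * derivative h, ?_, ?_⟩
    · have h3 := congrArg (fun q => X * derivative q) h1
      simp only [derivative_sum, derivative_mul, derivative_C, zero_mul, zero_add,
        mul_sum, derivative_pow, derivative_sub, derivative_X, derivative_one, sub_zero, mul_one,
        Nat.cast_add, Nat.cast_one, Nat.add_sub_cancel] at h3
      rw [ha']
      calc _ = _ := ?_
        _ = _ := h3
        _ = _ := ?_
      · refine sum_congr rfl fun j _ => ?_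
        rcases j with _ | j
        · simp
        · simp only [Nat.add_sub_cancel, pow_succ, C_mul]; simp; ring
      · simp; ring
    · simp [h2, hc, Nat.factorial_succ]; ring

open Polynomial Finset in
theorem exists_prod_X_pow_mul_one_sub_X_pow_eq (R : Type*) [CommRing R] (a m : ℕ) :
    ∃ h : R[X], ∏ k ∈ range m, X ^ (a * (k + 1)) * (1 - X ^ (k + 1)) = (X - 1) ^ m * h ∧
      h.eval 1 = (-1) ^ m * (m.factorial : R) := by
  induction m with
  | zero => exact ⟨1, by simp⟩
  | succ m ih =>
    obtain ⟨h, h1, h2⟩ := ih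
    refine ⟨h * (X ^ (a * (m + 1)) * (- ∑ j ∈ range (m + 1), X ^ j)), ?_, ?_⟩
    · rw [prod_range_succ, h1, ← neg_sub (X ^ (m + 1)) 1, ← geom_sum_mul]
      ring
    · simp [h2, eval_finsetSum, Nat.factorial_succ]; ring

open Polynomial Finset in
/-- The sign relating the quadratic Gauss sum to `∏ ζ^(mk) (1 - ζ^k)` is `1` modulo `p`: lift the
equation to `ℤ[X]` modulo the cyclotomic polynomial, which is `(X - 1)^(p-1)` modulo `p`, and
compare the leading terms at `X = 1`. -/
theorem sign_eq_one_of_sum_legendreSym_eq (p m : ℕ) [Fact p.Prime] (hm : p = 2 * m + 1)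
    (hm0 : m ≠ 0) {ζ : ℂ} (hζ : IsPrimitiveRoot ζ p) (δ : ℤ)
    (h : ∑ j ∈ range p, (legendreSym p j : ℂ) * ζ ^ j =
      δ * ∏ k ∈ range m, ζ ^ (m * (k + 1)) * (1 - ζ ^ (k + 1))) : (δ : ZMod p) = 1 := by
  have hp : p.Prime := Fact.out
  set F : ℤ[X] := ∑ j ∈ range p, C (legendreSym p j) * X ^ j -
    C δ * ∏ k ∈ range m, X ^ (m * (k + 1)) * (1 - X ^ (k + 1)) with hF
  have h1 : cyclotomic p ℤ ∣ F := by
    rw [cyclotomic_eq_minpoly hζ hp.pos]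
    refine minpoly.isIntegrallyClosed_dvd (hζ.isIntegral hp.pos) ?_
    simp [hF, map_sum, map_prod, h]
  have h2 := Polynomial.map_dvd (Int.castRingHom (ZMod p)) h1
  obtain ⟨f, hf, hf1⟩ := exists_sum_pow_mul_X_pow_eq p m (by omega)
  obtain ⟨g, hg, hg1⟩ := exists_prod_X_pow_mul_one_sub_X_pow_eq (ZMod p) m m
  have h0 : (X - 1 : (ZMod p)[X]) ≠ 0 := X_sub_C_ne_zero (1 : ZMod p)
  have hcyc : (X - 1 : (ZMod p)[X]) ^ (m + m) = cyclotomic p (ZMod p) := by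
    apply mul_right_cancel₀ h0
    rw [cyclotomic_prime_mul_X_sub_one, ← pow_succ, show m + m + 1 = p by omega, sub_pow_char]
    simp
  have hFm : F.map (Int.castRingHom (ZMod p)) = (X - 1) ^ m * (f - C (δ : ZMod p) * g) := by
    have : p - 1 - m = m := by omega
    rw [this] at hf
    rw [mul_sub, ← hf, mul_left_comm, ← hg, hF]
    have hpm : p / 2 = m := by omega
    have hleg (j : ℕ) : Int.castRingHom (ZMod p) (legendreSym p j) = (j : ZMod p) ^ m := by
      rw [eq_intCast, legendreSym.eq_pow, hpm, Int.cast_natCast]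
    have hδ : Int.castRingHom (ZMod p) δ = δ := eq_intCast _ _
    simp only [Polynomial.map_sub, Polynomial.map_mul, Polynomial.map_sum, Polynomial.map_prod,
      Polynomial.map_pow, map_C, map_X, Polynomial.map_one, hleg, hδ]
  rw [map_cyclotomic, ← hcyc, hFm, pow_add] at h2
  have h3 := (mul_dvd_mul_iff_left (pow_ne_zero m h0)).mp h2
  obtain ⟨w, hw⟩ := (dvd_pow_self _ hm0).trans h3
  have h4 := congrArg (eval 1) hw
  simp only [eval_sub, eval_mul, eval_C, hf1, hg1, eval_X, eval_one, sub_self, zero_mul] at h4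
  have h5 : ((-1) ^ m * (m.factorial : ZMod p)) ≠ 0 := by
    refine mul_ne_zero (pow_ne_zero _ (by simp)) ?_
    rw [Ne, ZMod.natCast_eq_zero_iff, hp.dvd_factorial]
    omega
  apply mul_right_cancel₀ h5
  linear_combination -h4
open Finset in
theorem prod_neg_one_pow_mul_neg_I (m : ℕ) :
    ∏ k ∈ range m, ((-1) ^ (k + 1) * -Complex.I) = cP (2 * m + 1) := by
  induction m with
  | zero => simp [cP]
  | succ m ih =>
    rw [prod_range_succ, ih, cP, cP]
    rcases Nat.even_or_odd' m with ⟨n, rfl | rfl⟩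
    · rw [if_pos (by omega), if_neg (by omega)]
      simp [pow_succ, pow_mul]
    · rw [if_neg (by omega), if_pos (by omega)]
      simp [pow_succ, pow_mul]

theorem cP_sq (m : ℕ) : cP (2 * m + 1) ^ 2 = (-1) ^ m := by
  rw [cP]
  rcases Nat.even_or_odd' m with ⟨n, rfl | rfl⟩
  · rw [if_pos (by omega)]
    simp [pow_mul]
  · rw [if_neg (by omega)]
    simp [pow_succ, pow_mul]

open Finset Polynomial in
theorem prod_pow_mul_one_sub_pow_sq (p m : ℕ) [Fact p.Prime] (hm : p = 2 * m + 1)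
    {ζ : ℂ} (hζ : IsPrimitiveRoot ζ p) :
    (∏ k ∈ range m, ζ ^ (m * (k + 1)) * (1 - ζ ^ (k + 1))) ^ 2 = (-1) ^ m * p := by
  have hall : ∏ k ∈ range (m + m), (1 - ζ ^ (k + 1)) = p := by
    have hζ' : IsPrimitiveRoot ζ (m + m + 1) := by rwa [← two_mul, ← hm]
    rw [hζ'.prod_one_sub_pow_eq_order, hm]
    push_cast
    ring
  rw [← hall, prod_range_add, ← prod_range_reflect (fun k => 1 - ζ ^ (m + k + 1)), ← prod_pow,
    ← prod_mul_distrib, (by simp : (-1 : ℂ) ^ m = ∏ _k ∈ range m, (-1 : ℂ)), ← prod_mul_distrib]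
  refine prod_congr rfl fun k hk => ?_
  rw [mem_range] at hk
  have e1 : ζ ^ (m * (k + 1)) * ζ ^ (m * (k + 1)) * ζ ^ (k + 1) = 1 := by
    rw [← pow_add, ← pow_add, show m * (k + 1) + m * (k + 1) + (k + 1) = p * (k + 1) by
      rw [hm]; ring, pow_mul, hζ.pow_eq_one, one_pow]
  have e2 : ζ ^ (m + (m - 1 - k) + 1) * ζ ^ (k + 1) = 1 := by
    rw [← pow_add, show m + (m - 1 - k) + 1 + (k + 1) = p by omega, hζ.pow_eq_one]
  have e3 : ζ ^ (m + (m - 1 - k) + 1) = ζ ^ (m * (k + 1)) * ζ ^ (m * (k + 1)) :=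
    mul_right_cancel₀ (pow_ne_zero (k + 1) (hζ.ne_zero (by omega))) (e2.trans e1.symm)
  rw [e3]
  linear_combination (ζ ^ (k + 1) - 1) * e1

open Finset in
theorem prod_pow_mul_one_sub_pow_eq_cP_mul (p m : ℕ) (hm : p = 2 * m + 1) :
    ∃ R : ℝ, 0 < R ∧ ∏ k ∈ range m, Complex.exp (2 * Real.pi * Complex.I / p) ^ (m * (k + 1)) *
      (1 - Complex.exp (2 * Real.pi * Complex.I / p) ^ (k + 1)) = cP p * R := by
  refine ⟨∏ k ∈ range m, 2 * Real.sin (Real.pi * (k + 1) / p), prod_pos fun k hk => ?_, ?_⟩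
  · rw [mem_range] at hk
    have hp : (0 : ℝ) < p := by rw [hm]; positivity
    refine mul_pos two_pos (Real.sin_pos_of_pos_of_lt_pi (by positivity) ?_)
    rw [div_lt_iff₀ hp]
    refine mul_lt_mul_of_pos_left ?_ Real.pi_pos
    rw [hm]
    exact_mod_cast (by omega : k + 1 < 2 * m + 1)
  · rw [hm, ← prod_neg_one_pow_mul_neg_I, ← hm]
    push_cast
    rw [← prod_mul_distrib]
    refine prod_congr rfl fun k _ => ?_
    have hp : (p : ℂ) ≠ 0 := Nat.cast_ne_zero.mpr (by omega)
    set x : ℂ := Real.pi * (k + 1) / p with hx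
    have e1 : Complex.exp (2 * Real.pi * Complex.I / p) ^ (k + 1) =
        Complex.exp (x * Complex.I) * Complex.exp (x * Complex.I) := by
      rw [← Complex.exp_nat_mul, ← Complex.exp_add]
      congr 1
      rw [hx]; push_cast; ring
    have e2 : Complex.exp (2 * Real.pi * Complex.I / p) ^ (m * (k + 1)) =
        (-1) ^ (k + 1) * Complex.exp (-x * Complex.I) := by
      rw [← Complex.exp_pi_mul_I, ← Complex.exp_nat_mul, ← Complex.exp_nat_mul, ← Complex.exp_add]
      congr 1
      have : (p : ℂ) = 2 * m + 1 := by rw [hm]; push_cast; ring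
      rw [hx]; field_simp; push_cast; rw [this]; ring
    have e3 : Complex.exp (-x * Complex.I) * Complex.exp (x * Complex.I) = 1 := by
      rw [← Complex.exp_add]; simp
    rw [e1, e2, Complex.sin]
    linear_combination (-(-1) ^ (k + 1) * Complex.exp (x * Complex.I)) * e3 +
      (-1) ^ (k + 1) * (Complex.exp (-x * Complex.I) - Complex.exp (x * Complex.I)) * Complex.I_sq

open Finset in
theorem sum_range_legendreSym_mul_exp_pow (p : ℕ) [Fact p.Prime] :
    ∑ j ∈ range p, (legendreSym p j : ℂ) * Complex.exp (2 * Real.pi * Complex.I / p) ^ j =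
      gaussSum ((quadraticChar (ZMod p)).ringHomComp (Int.castRingHom ℂ))
        (ZMod.stdAddChar (N := p)) := by
  rw [gaussSum]
  symm
  refine sum_bij (fun a _ => a.val) (fun a _ => mem_range.mpr a.val_lt)
    (fun a _ b _ h => ZMod.val_injective p h)
    (fun j hj => ⟨j, mem_univ _, ZMod.val_cast_of_lt (mem_range.mp hj)⟩) fun a _ => ?_
  rw [legendreSym, ← Complex.exp_nat_mul]
  have h := ZMod.stdAddChar_coe (N := p) a.val
  rw [Int.cast_natCast, ZMod.natCast_zmod_val] at h
  rw [h, Int.cast_natCast, Int.cast_natCast, ZMod.natCast_zmod_val]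
  simp only [MulChar.ringHomComp_apply, eq_intCast]
  congr 2
  ring

open Finset in
/-- The evaluation of the quadratic Gauss sum, including its sign. -/
theorem gaussSum_quadraticChar_stdAddChar (p : ℕ) [Fact p.Prime] (hp : Odd p) :
    gaussSum ((quadraticChar (ZMod p)).ringHomComp (Int.castRingHom ℂ))
      (ZMod.stdAddChar (N := p)) = cP p * (Real.sqrt p : ℂ) := by
  have hpp : p.Prime := Fact.out
  obtain ⟨m, hm⟩ := hp
  have hm0 : m ≠ 0 := by
    rintro rfl
    exact hpp.ne_one hm
  have hp2 : ringChar (ZMod p) ≠ 2 := by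
    rw [ZMod.ringChar_zmod_n]; omega
  have hζ := Complex.isPrimitiveRoot_exp p hpp.ne_zero
  obtain ⟨R, hR, hV⟩ := prod_pow_mul_one_sub_pow_eq_cP_mul p m hm
  have hV2 := prod_pow_mul_one_sub_pow_sq p m hm hζ
  have hneg : ((-1 : ℂ) ^ m) ≠ 0 := pow_ne_zero _ (by simp)
  have hR2 : R = Real.sqrt p := by
    symm
    rw [Real.sqrt_eq_iff_mul_self_eq (by positivity) hR.le]
    have : (-1 : ℂ) ^ m * (R : ℂ) ^ 2 = (-1) ^ m * p := by
      rw [← hV2, hV, mul_pow, ← cP_sq m, hm]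
    have h := mul_left_cancel₀ hneg this
    rw [← sq]
    exact_mod_cast h.symm
  have hG2 : gaussSum ((quadraticChar (ZMod p)).ringHomComp (Int.castRingHom ℂ))
      (ZMod.stdAddChar (N := p)) ^ 2 = (-1) ^ m * p := by
    rw [gaussSum_sq ((MulChar.ringHomComp_ne_one_iff Int.cast_injective).mpr
      (quadraticChar_ne_one hp2)) ((quadraticChar_isQuadratic _).comp _)
      (ZMod.isPrimitive_stdAddChar p), ZMod.card, MulChar.ringHomComp_apply,
      quadraticChar_neg_one hp2, ZMod.card, ZMod.χ₄_eq_neg_one_pow (by omega),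
      show p / 2 = m by omega]
    simp
  rw [← sum_range_legendreSym_mul_exp_pow] at hG2 ⊢
  rw [← hR2, ← hV]
  rcases sq_eq_sq_iff_eq_or_eq_neg.mp (hG2.trans hV2.symm) with h | h
  · exact h
  · exfalso
    have := sign_eq_one_of_sum_legendreSym_eq p m hm hm0 hζ (-1) (by rw [h]; simp)
    have h2 : ((2 : ℕ) : ZMod p) = 0 := by
      push_cast at this ⊢
      linear_combination -this
    rw [ZMod.natCast_eq_zero_iff] at h2
    have := Nat.le_of_dvd two_pos h2
    omega

open Finset in
theorem card_mul_sum_comp_of_surjective {G H : Type*} [Group G] [Group H] [Fintype G] [Fintype H]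
    (φ : G →* H) (hφ : Function.Surjective φ) (f : H → ℂ) :
    (Fintype.card H : ℂ) * ∑ g, f (φ g) = Fintype.card G * ∑ h, f h := by
  classical
  have key (f : H → ℂ) : ∑ g, f (φ g) = #{g | φ g = 1} * ∑ h, f h := by
    rw [← sum_fiberwise univ φ, mul_sum]
    refine sum_congr rfl fun h _ => ?_
    rw [← MonoidHom.card_fiber_eq_of_mem_range φ (hφ h) (hφ 1), ← nsmul_eq_mul, ← sum_const]
    refine sum_congr rfl fun g hg => ?_
    rw [(mem_filter.mp hg).2]
  have h1 := key fun _ => 1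
  simp only [sum_const, card_univ, nsmul_eq_mul, mul_one] at h1
  rw [key, h1]
  ring

/-- Each fibre of the reduction `(ℤ/p^(n+1))ˣ → (ℤ/p)ˣ` has `p^n` elements. -/
theorem sum_units_unitsMap (p n : ℕ) [Fact p.Prime] (f : (ZMod p)ˣ → ℂ) :
    ∑ d : (ZMod (p ^ (n + 1)))ˣ, f (ZMod.unitsMap (dvd_pow_self p n.succ_ne_zero) d) =
      (p : ℂ) ^ n * ∑ u, f u := by
  have hp : p.Prime := Fact.out
  have h := card_mul_sum_comp_of_surjective _
    (ZMod.unitsMap_surjective (dvd_pow_self p n.succ_ne_zero)) f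
  rw [ZMod.card_units_eq_totient, ZMod.card_units_eq_totient, Nat.totient_prime_pow_succ hp,
    Nat.totient_prime hp] at h
  have h0 : ((p - 1 : ℕ) : ℂ) ≠ 0 := Nat.cast_ne_zero.mpr (by have := hp.two_le; omega)
  apply mul_left_cancel₀ h0
  rw [h]
  push_cast
  ring

theorem sum_eq_add_sum_units {F : Type*} [Field F] [Fintype F] [DecidableEq F] (f : F → ℂ) :
    ∑ x, f x = f 0 + ∑ u : Fˣ, f u := by
  rw [Fintype.sum_eq_add_sum_subtype_ne f 0]
  congr 1
  exact (Fintype.sum_equiv unitsEquivNeZero _ _ fun _ => rfl).symm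

theorem stdAddChar_pow_mul (p n : ℕ) [NeZero p] (x : ZMod (p ^ (n + 1))) :
    ZMod.stdAddChar ((p : ZMod (p ^ (n + 1))) ^ n * x) =
      ZMod.stdAddChar (ZMod.castHom (dvd_pow_self p n.succ_ne_zero) (ZMod p) x) := by
  obtain ⟨m, rfl⟩ := ZMod.natCast_zmod_surjective x
  have h1 := ZMod.stdAddChar_coe (N := p ^ (n + 1)) (p ^ n * m)
  have h2 := ZMod.stdAddChar_coe (N := p) m
  rw [map_natCast]
  push_cast at h1 h2
  rw [h1, h2]
  have hp : (p : ℂ) ≠ 0 := Nat.cast_ne_zero.mpr (NeZero.ne p)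
  congr 1
  rw [pow_succ]
  field_simp

theorem legC_eq_quadraticChar (p : ℕ) [Fact p.Prime] {N : ℕ} [NeZero N] (h : p ∣ N) (x : ZMod N) :
    legC p x = (quadraticChar (ZMod p)).ringHomComp (Int.castRingHom ℂ)
      (ZMod.castHom h (ZMod p) x) := by
  rw [legC, legendreSym, MulChar.ringHomComp_apply, eq_intCast, Int.cast_natCast, ZMod.castHom_apply,
    ZMod.cast_eq_val]

/-- For `k = i - 1` and `j = i` the sum `P1` reduces to a sum over the units of `ZMod p`. -/
theorem P1_top_eq (p n : ℕ) [Fact p.Prime] (r : ℤ) (β b : (ZMod (p ^ (n + 1)))ˣ) (a : (ZMod p)ˣ)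
    (ha : (a : ZMod p) = ZMod.castHom (dvd_pow_self p n.succ_ne_zero) (ZMod p) b * r) :
    P1 p (n + 1) r β b (n + 1) n = (p : ℂ) ^ n * ∑ u : (ZMod p)ˣ,
      (quadraticChar (ZMod p)).ringHomComp (Int.castRingHom ℂ) (a * (u⁻¹ : (ZMod p)ˣ)) ^ (n + 1) *
        ZMod.stdAddChar (u : ZMod p) := by
  have hreindex : ∑ u : (ZMod p)ˣ,
      (quadraticChar (ZMod p)).ringHomComp (Int.castRingHom ℂ) (a * (u⁻¹ : (ZMod p)ˣ)) ^ (n + 1) *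
        ZMod.stdAddChar (u : ZMod p) = ∑ u : (ZMod p)ˣ,
      (quadraticChar (ZMod p)).ringHomComp (Int.castRingHom ℂ) (u : ZMod p) ^ (n + 1) *
        ZMod.stdAddChar ((a : ZMod p) * ((u⁻¹ : (ZMod p)ˣ) : ZMod p)) := by
    refine Fintype.sum_equiv ((Equiv.inv _).trans (Equiv.mulLeft a)) _ _ fun u => ?_
    simp only [Equiv.trans_apply, Equiv.inv_apply, Equiv.coe_mulLeft, ← Units.val_mul]
    rw [show a * (a * u⁻¹)⁻¹ = u by
      rw [_root_.mul_inv_rev, inv_inv, mul_comm u, mul_inv_cancel_left]]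
  rw [hreindex, ← sum_units_unitsMap, P1]
  refine Finset.sum_congr rfl fun d _ => ?_
  have hpow : (p : ZMod (p ^ (n + 1))) ^ (n + 1) = 0 := by
    rw [← Nat.cast_pow, ZMod.natCast_self]
  rw [legC_eq_quadraticChar p (dvd_pow_self p n.succ_ne_zero), aChar_eq_stdAddChar, hpow, zero_mul,
    zero_mul, zero_add, mul_assoc, mul_left_comm, stdAddChar_pow_mul, ← map_inv]
  simp only [map_mul, map_intCast, ZMod.unitsMap_def, Units.coe_map, MonoidHom.coe_coe, ha]
  congr 2
  ring

theorem P1_eq_zero_of_lt (p i j k : ℕ) [Fact p.Prime] (hkj : k < j) (r : ℤ) (hpr : ¬ ((p : ℤ) ∣ r))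
    (β b : (ZMod (p ^ i))ˣ) (hk : k < i - 1) : P1 p i r β b j k = 0 := by
  obtain ⟨n, rfl⟩ : ∃ n, i = n + 1 := ⟨i - 1, by omega⟩
  obtain ⟨l, hn⟩ : ∃ l, n = k + l + 1 := ⟨n - k - 1, by omega⟩
  have hdvd := dvd_pow_self p n.succ_ne_zero
  set ε : ZMod (p ^ (n + 1)) := (p : ZMod (p ^ (n + 1))) ^ (l + 1) with hε
  have hpow : (p : ZMod (p ^ (n + 1))) ^ (n + 1) = 0 := by
    rw [← Nat.cast_pow, ZMod.natCast_self]
  have hεnil : IsNilpotent ε := 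
    ⟨n + 1, by rw [hε, ← pow_mul, mul_comm, pow_mul, hpow, zero_pow (by omega)]⟩
  have hjε : (p : ZMod (p ^ (n + 1))) ^ j * ε = 0 := by
    obtain ⟨t, rfl⟩ : ∃ t, j = k + 1 + t := ⟨j - (k + 1), by omega⟩
    have h : (p : ZMod (p ^ (n + 1))) ^ (k + 1 + t) * ε = (p : ZMod (p ^ (n + 1))) ^ (n + 1) *
        (p : ZMod (p ^ (n + 1))) ^ t := by
      rw [hε, ← pow_add, ← pow_add]
      congr 1
      omega
    rw [h, hpow, zero_mul]
  have hkε : (p : ZMod (p ^ (n + 1))) ^ n = (p : ZMod (p ^ (n + 1))) ^ k * ε := by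
    rw [hε, ← pow_add]
    congr 1
  have hεp : ZMod.castHom hdvd (ZMod p) ε = 0 := by
    rw [hε, map_pow, map_natCast, CharP.cast_eq_zero, zero_pow (by omega)]
  let shift : (ZMod (p ^ (n + 1)))ˣ ≃ (ZMod (p ^ (n + 1)))ˣ :=
    { toFun := fun e => (hεnil.isUnit_add_left_of_commute e.isUnit (Commute.all _ _)).unit
      invFun := fun e => (hεnil.neg.isUnit_add_left_of_commute e.isUnit (Commute.all _ _)).unit
      left_inv := fun e => by ext; simp
      right_inv := fun e => by ext; simp }
  have hshift (e) : ((shift e : (ZMod (p ^ (n + 1)))ˣ) : ZMod (p ^ (n + 1))) = e + ε := rfl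
  set c : ℂ := ZMod.stdAddChar ((r : ZMod (p ^ (n + 1))) *
    ((p : ZMod (p ^ (n + 1))) ^ k * (b : ZMod (p ^ (n + 1))) * ε)) with hc
  have hc1 : c ≠ 1 := by
    rw [hc, show (r : ZMod (p ^ (n + 1))) *
      ((p : ZMod (p ^ (n + 1))) ^ k * (b : ZMod (p ^ (n + 1))) * ε) =
      (p : ZMod (p ^ (n + 1))) ^ n * ((r : ZMod (p ^ (n + 1))) * (b : ZMod (p ^ (n + 1)))) by
        rw [hkε]; ring, stdAddChar_pow_mul,
      ← AddChar.map_zero_eq_one (ZMod.stdAddChar (N := p)), ZMod.injective_stdAddChar.ne_iff,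
      map_mul, map_intCast]
    refine mul_ne_zero ?_ (b.isUnit.map _).ne_zero
    rwa [Ne, ZMod.intCast_zmod_eq_zero_iff_dvd]
  have hinv : P1 p (n + 1) r β b j k = ∑ e : (ZMod (p ^ (n + 1)))ˣ,
      legC p ((e⁻¹ : (ZMod (p ^ (n + 1)))ˣ) : ZMod (p ^ (n + 1))) ^ (n + 1) *
      aChar (p ^ (n + 1)) r ((p : ZMod (p ^ (n + 1))) ^ j * β * (e⁻¹ : (ZMod (p ^ (n + 1)))ˣ) +
        (p : ZMod (p ^ (n + 1))) ^ k * b * e) :=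
    Fintype.sum_equiv (Equiv.inv _) _ _ fun d => by simp
  have hmul : P1 p (n + 1) r β b j k = c * P1 p (n + 1) r β b j k := by
    conv_rhs => rw [hinv]
    rw [hinv, Finset.mul_sum]
    symm
    refine Fintype.sum_equiv shift _ _ fun e => ?_
    have hinve : (((shift e)⁻¹ : (ZMod (p ^ (n + 1)))ˣ) : ZMod (p ^ (n + 1))) =
        (e⁻¹ : (ZMod (p ^ (n + 1)))ˣ) - ε * ((e⁻¹ : (ZMod (p ^ (n + 1)))ˣ) *
          ((shift e)⁻¹ : (ZMod (p ^ (n + 1)))ˣ)) := by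
      have h1 := (shift e).mul_inv
      have h2 := e.mul_inv
      rw [hshift] at h1
      linear_combination (e⁻¹ : (ZMod (p ^ (n + 1)))ˣ) * h1 -
        ((shift e)⁻¹ : (ZMod (p ^ (n + 1)))ˣ) * h2
    have hleg : legC p (((shift e)⁻¹ : (ZMod (p ^ (n + 1)))ˣ) : ZMod (p ^ (n + 1))) =
        legC p ((e⁻¹ : (ZMod (p ^ (n + 1)))ˣ) : ZMod (p ^ (n + 1))) := by
      rw [legC_eq_quadraticChar p hdvd, legC_eq_quadraticChar p hdvd, hinve, map_sub, map_mul, hεp,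
        zero_mul, sub_zero]
    rw [hleg, aChar_eq_stdAddChar, aChar_eq_stdAddChar, hshift, mul_left_comm, hc,
      ← AddChar.map_add_eq_mul, hinve]
    congr 2
    linear_combination (r * β * ((e⁻¹ : (ZMod (p ^ (n + 1)))ˣ) *
      ((shift e)⁻¹ : (ZMod (p ^ (n + 1)))ˣ)) : ZMod (p ^ (n + 1))) * hjε
  have : (c - 1) * P1 p (n + 1) r β b j k = 0 := by linear_combination -hmul
  exact (mul_eq_zero.mp this).resolve_left (sub_ne_zero.mpr hc1)

/-- §4, case (iii): for `0 ≤ k < j ≤ i`, the sum `P₁ = Σ_d (d/p)^i λ(p^j βd + p^k b d⁻¹)`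
equals `−p^{i−1}` if `k = i−1` and `i` is even, `(br/p)·c_p·p^{i−1}·√p` if `k = i−1`
and `i` is odd, and `0` if `k < i−1`. -/
theorem appendix_case_iii (p i j k : ℕ) [Fact p.Prime] (hp : Odd p)
    (hkj : k < j) (hji : j ≤ i)
    (r : ℤ) (hpr : ¬ ((p : ℤ) ∣ r)) (β b : (ZMod (p ^ i))ˣ) :
    (k = i - 1 → Even i → P1 p i r β b j k = -(p : ℂ) ^ (i - 1)) ∧
    (k = i - 1 → Odd i → P1 p i r β b j k =
      (legendreSym p (((b : ZMod (p ^ i)).val : ℤ) * r) : ℂ) * cP p * (p : ℂ) ^ (i - 1) *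
        (Real.sqrt p : ℂ)) ∧
    (k < i - 1 → P1 p i r β b j k = 0) := by
  refine ⟨fun hk hi => ?_, fun hk hi => ?_, P1_eq_zero_of_lt p i j k hkj r hpr β b⟩
  all_goals
    obtain ⟨n, rfl⟩ : ∃ n, i = n + 1 := ⟨i - 1, by omega⟩
    obtain rfl : j = n + 1 := by omega
    obtain rfl : k = n := by omega
    have hdvd := dvd_pow_self p k.succ_ne_zero
    have hr : (r : ZMod p) ≠ 0 := by rwa [Ne, ZMod.intCast_zmod_eq_zero_iff_dvd]
    have hu : ZMod.castHom hdvd (ZMod p) b * r ≠ 0 := mul_ne_zero (b.isUnit.map _).ne_zero hr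
    rw [P1_top_eq p k r β b (Units.mk0 _ hu) rfl, Nat.add_sub_cancel]
    have hχ (x : (ZMod p)ˣ) :
        (quadraticChar (ZMod p)).ringHomComp (Int.castRingHom ℂ) (x : ZMod p) ^ 2 = 1 := by
      rw [MulChar.ringHomComp_apply, ← map_pow, quadraticChar_sq_one x.ne_zero, map_one]
  · have hne : ZMod.stdAddChar (N := p) ≠ 1 := by
      simpa using ZMod.isPrimitive_stdAddChar p one_ne_zero
    have hsum := sum_eq_add_sum_units (ZMod.stdAddChar (N := p))
    rw [AddChar.sum_eq_zero_of_ne_one hne,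
      AddChar.map_zero_eq_one] at hsum
    obtain ⟨t, ht⟩ := hi
    rw [← two_mul] at ht
    simp only [ht, pow_mul, ← Units.val_mul, hχ, one_pow, one_mul]
    linear_combination -(p : ℂ) ^ k * hsum
  · have hsum := gaussSum_quadraticChar_stdAddChar p hp
    rw [gaussSum, sum_eq_add_sum_units, MulChar.map_zero, zero_mul, zero_add] at hsum
    obtain ⟨t, ht⟩ := hi
    have hinv (x : (ZMod p)ˣ) : (quadraticChar (ZMod p)).ringHomComp (Int.castRingHom ℂ)
        ((x⁻¹ : (ZMod p)ˣ) : ZMod p) =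
        (quadraticChar (ZMod p)).ringHomComp (Int.castRingHom ℂ) (x : ZMod p) := by
      have h1 := hχ x
      have h2 : (quadraticChar (ZMod p)).ringHomComp (Int.castRingHom ℂ) (x : ZMod p) *
        (quadraticChar (ZMod p)).ringHomComp (Int.castRingHom ℂ) ((x⁻¹ : (ZMod p)ˣ) : ZMod p) =
          1 := by
        rw [← map_mul, Units.mul_inv, map_one]
      linear_combination (quadraticChar (ZMod p)).ringHomComp (Int.castRingHom ℂ) (x : ZMod p) * h2 -
        (quadraticChar (ZMod p)).ringHomComp (Int.castRingHom ℂ) ((x⁻¹ : (ZMod p)ˣ) : ZMod p) * h1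
    have hleg : (legendreSym p (((b : ZMod (p ^ (k + 1))).val : ℤ) * r) : ℂ) =
        (quadraticChar (ZMod p)).ringHomComp (Int.castRingHom ℂ)
          (ZMod.castHom hdvd (ZMod p) b * r) := by
      rw [legendreSym, MulChar.ringHomComp_apply, eq_intCast, Int.cast_mul, Int.cast_natCast,
        ZMod.castHom_apply, ZMod.cast_eq_val]
    simp only [ht, pow_add, pow_mul, ← Units.val_mul, hχ, one_pow, one_mul, pow_one]
    simp only [Units.val_mul, map_mul, hinv, Units.val_mk0, mul_assoc, ← Finset.mul_sum, hsum]
    rw [hleg, map_mul]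
    ring
end
end
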